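/- Let N = 19 and let τ = (−19 + √−19)/38 ∈ ℍ (real part −1/2 and imaginary part √19/38). Then E₂^{(19)}(τ) ≠ 0, a₄′(τ) = −1/38, and a₆′(τ) = 1/608; that is, the codomain of the cyclic 19-isogeny attached to this point has Weierstrass model y² = x³ − (1/38)x + 1/608. -/

import Mathlib

open Complex UpperHalfPlane Matrix MatrixGroups Filter

/-- `q = e^{2πiτ}`. -/
noncomputable def qExp (τ : ℂ) : ℂ := Complex.exp (2 * Real.pi * Complex.I * τ)

/-- `σ_k(n) = Σ_{d ∣ n} d^k`. -/
def sigma' (k n : ℕ) : ℕ := ∑ d ∈ n.divisors, d ^ k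

/-- Normalized Eisenstein series `E₄(τ) = 1 + 240 Σ_{n≥1} σ₃(n) qⁿ`. -/
noncomputable def E4 (τ : ℂ) : ℂ := 1 + 240 * ∑' n : ℕ+, (sigma' 3 n : ℂ) * qExp τ ^ (n : ℕ)

/-- Normalized Eisenstein series `E₆(τ) = 1 − 504 Σ_{n≥1} σ₅(n) qⁿ`. -/
noncomputable def E6 (τ : ℂ) : ℂ := 1 - 504 * ∑' n : ℕ+, (sigma' 5 n : ℂ) * qExp τ ^ (n : ℕ)

/-- Normalized weight-2 Eisenstein series `E₂(τ) = 1 − 24 Σ_{n≥1} σ₁(n) qⁿ`. -/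
noncomputable def E2 (τ : ℂ) : ℂ := 1 - 24 * ∑' n : ℕ+, (sigma' 1 n : ℂ) * qExp τ ^ (n : ℕ)

/-- `E₂^{(N)}(τ) = (N−1)/24 + Σ_{n≥1} σ₁(n)(qⁿ − N q^{Nn})`. -/
noncomputable def E2N (N : ℕ) (τ : ℂ) : ℂ :=
  ((N : ℂ) - 1) / 24 +
    ∑' n : ℕ+, (sigma' 1 n : ℂ) * (qExp τ ^ (n : ℕ) - (N : ℂ) * qExp τ ^ (N * (n : ℕ)))

/-- `a₄(τ) = −E₄(τ)/(48 E₂^{(N)}(τ)²)`. -/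
noncomputable def a4 (N : ℕ) (τ : ℂ) : ℂ := -E4 τ / (48 * E2N N τ ^ 2)

/-- `a₆(τ) = E₆(τ)/(864 E₂^{(N)}(τ)³)`. -/
noncomputable def a6 (N : ℕ) (τ : ℂ) : ℂ := E6 τ / (864 * E2N N τ ^ 3)

/-- `a₄′(τ) = −E₄(Nτ)/(48 E₂^{(N)}(τ)²)`. -/
noncomputable def a4' (N : ℕ) (τ : ℂ) : ℂ := -E4 ((N : ℂ) * τ) / (48 * E2N N τ ^ 2)

/-- `a₆′(τ) = E₆(Nτ)/(864 E₂^{(N)}(τ)³)`. -/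
noncomputable def a6' (N : ℕ) (τ : ℂ) : ℂ := E6 ((N : ℂ) * τ) / (864 * E2N N τ ^ 3)

noncomputable def Gz (k : ℕ) (z : ℍ) : ℂ := ∑' v : Fin 2 → ℤ, EisensteinSeries.eisSummand k v z

lemma qExp_eq (z : ℂ) (n : ℕ) : cexp (2 * Real.pi * Complex.I * z) ^ n = qExp z ^ n := rfl

lemma sigma'_eq (k n : ℕ) : sigma' k n = ArithmeticFunction.sigma k n := by
  simp [sigma', ArithmeticFunction.sigma_apply]

lemma Gz_four (z : ℍ) : Gz 4 z = (Real.pi : ℂ) ^ 4 / 45 * E4 z := by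
  have h := tsum_eisSummand_eq_tsum_sigma_mul_cexp_pow (k := 4) (by norm_num) ⟨2, rfl⟩ z
  rw [Gz, h, E4]
  simp only [sigma'_eq, ← qExp_eq]
  have : riemannZeta ((4:ℕ):ℂ) = (Real.pi : ℂ) ^ 4 / 90 := by
    exact_mod_cast riemannZeta_four
  rw [this]
  have hI : Complex.I ^ 4 = 1 := I_pow_four
  simp only [mul_pow, hI]
  norm_num [Nat.factorial]
  ring

lemma Gz_six (z : ℍ) : Gz 6 z = 2 * (Real.pi : ℂ) ^ 6 / 945 * E6 z := by
  have h := tsum_eisSummand_eq_tsum_sigma_mul_cexp_pow (k := 6) (by norm_num) ⟨3, rfl⟩ z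
  rw [Gz, h, E6]
  simp only [sigma'_eq, ← qExp_eq]
  have : riemannZeta ((6:ℕ):ℂ) = (Real.pi : ℂ) ^ 6 / 945 := by
    have := riemannZeta_two_mul_nat (k := 3) (by norm_num)
    have hb : bernoulli 6 = 1 / 42 := by decide +kernel
    norm_num [hb, Nat.factorial] at this ⊢
    rw [this]; ring
  rw [this]
  have hI : Complex.I ^ 6 = -1 := by rw [show Complex.I ^ 6 = Complex.I ^ 4 * Complex.I ^ 2 by ring, I_pow_four, I_sq]; ring
  simp only [mul_pow, hI]
  norm_num [Nat.factorial]
  ring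

lemma Gz_eq_E {k : ℕ} (hk : 3 ≤ k) (z : ℍ) :
    Gz k z = 2 * riemannZeta k * ModularForm.E hk z := by
  rw [Gz, tsum_eisSummand_eq_riemannZeta_mul_eisensteinSeries hk,
    show ModularForm.E hk z = (1 / 2 : ℂ) • EisensteinSeries.eisensteinSeriesSIF (N := 1) 0 k z from rfl,
    EisensteinSeries.eisensteinSeriesSIF_apply 0 k z]
  simp only [smul_eq_mul]
  ring

lemma E8_eq (z : ℍ) : ModularForm.E (k := 8) (by norm_num) z = (ModularForm.E₄ z) ^ 2 := by
  have hr : Module.rank ℂ (ModularForm 𝒮ℒ ((8 : ℕ) : ℤ)) = 1 := by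
    rw [ModularForm.dimension_level_one 8 ⟨4, rfl⟩]
    rw [if_neg (by decide)]; norm_num
  have hne := EisensteinSeries.E_ne_zero (k := 8) (by norm_num) ⟨4, rfl⟩
  obtain ⟨c, hc⟩ := (finrank_eq_one_iff_of_nonzero' _ hne).mp
      (Module.rank_eq_one_iff_finrank_eq_one.mp hr) (ModularForm.mcast (by norm_num) (ModularForm.E₄.pow 2))
  have h0 : c • qExpansion 1 (ModularForm.E (k := 8) (by norm_num)) =
      qExpansion 1 ModularForm.E₄ * qExpansion 1 ModularForm.E₄ := by
    rw [← ModularForm.qExpansion_smul one_pos one_mem_strictPeriods_SL c,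
      show (c • ModularForm.E (k := 8) (by norm_num) : ℍ → ℂ) = _ from congrArg DFunLike.coe hc]
    simp only [ModularForm.coe_mcast,
      ModularForm.qExpansion_pow one_pos one_mem_strictPeriods_SL]
    ring
  have h1 : c = 1 := by
    have h2 := congrArg (fun f => f.coeff 0) h0
    simpa [PowerSeries.coeff_mul, -PowerSeries.coeff_zero_eq_constantCoeff,
      EisensteinSeries.E_qExpansion_coeff_zero _ ⟨2, rfl⟩,
      EisensteinSeries.E_qExpansion_coeff_zero (k := 8) _ ⟨4, rfl⟩] using h2
  have := congrArg (fun f : ModularForm 𝒮ℒ ((8 : ℕ) : ℤ) => f z) hc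
  rw [h1, one_smul] at this
  exact this.trans (congrFun (ModularForm.coe_pow ModularForm.E₄ 2) z)

lemma Gz_eight (z : ℍ) : Gz 8 z = 3 / 7 * Gz 4 z ^ 2 := by
  rw [Gz_eq_E (k := 8) (by norm_num), Gz_eq_E (k := 4) (by norm_num), E8_eq]
  have h4 : riemannZeta ((4:ℕ):ℂ) = (Real.pi : ℂ) ^ 4 / 90 := by
    exact_mod_cast riemannZeta_four
  have h8 : riemannZeta ((8:ℕ):ℂ) = (Real.pi : ℂ) ^ 8 / 9450 := by
    have := riemannZeta_two_mul_nat (k := 4) (by norm_num)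
    have hb : bernoulli 8 = -1 / 30 := by decide +kernel
    norm_num [hb, Nat.factorial] at this ⊢
    rw [this]; ring
  rw [h4, h8]
  have : ModularForm.E₄ z = ModularForm.E (k := 4) (by norm_num) z := rfl
  rw [this]
  ring

lemma Gz_S (k : ℕ) (z w : ℍ) (h : (w : ℂ) = -1 / z) : Gz k w = (z : ℂ) ^ k * Gz k z := by
  have hz : (z : ℂ) ≠ 0 := ne_zero z
  let e : (Fin 2 → ℤ) ≃ (Fin 2 → ℤ) :=
    { toFun := fun v => ![v 1, - v 0]
      invFun := fun v => ![- v 1, v 0]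
      left_inv := fun v => by ext i; fin_cases i <;> simp
      right_inv := fun v => by ext i; fin_cases i <;> simp }
  rw [Gz, Gz, ← tsum_mul_left, ← e.tsum_eq (fun v => (z : ℂ) ^ k * EisensteinSeries.eisSummand k v z)]
  congr 1; ext v
  simp only [EisensteinSeries.eisSummand, h, e, Equiv.coe_fn_mk]
  simp only [_root_.zpow_neg, zpow_natCast, cons_val_zero, cons_val_one, Int.cast_neg]
  rw [show (v 0 : ℂ) * (-1 / z) + v 1 = (v 1 * z + - v 0) / z by field_simp; ring, div_pow, inv_div,
    div_eq_mul_inv]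

lemma qExp_add_int (z : ℂ) (n : ℤ) : qExp (z + n) = qExp z := by
  rw [qExp, qExp, mul_add, Complex.exp_add, show (2 * Real.pi * Complex.I * n : ℂ) = n * (2 * Real.pi * Complex.I) by ring,
    Complex.exp_int_mul_two_pi_mul_I, mul_one]

lemma E4_add_int (z : ℂ) (n : ℤ) : E4 (z + n) = E4 z := by simp only [E4, qExp_add_int]
lemma E6_add_int (z : ℂ) (n : ℤ) : E6 (z + n) = E6 z := by simp only [E6, qExp_add_int]
lemma E2_add_int (z : ℂ) (n : ℤ) : E2 (z + n) = E2 z := by simp only [E2, qExp_add_int]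

lemma G2_eq (z : ℍ) : EisensteinSeries.G2 z = (Real.pi : ℂ) ^ 2 / 3 * E2 z := by
  rw [EisensteinSeries.G2_eq_tsum_cexp, riemannZeta_two, E2]
  simp only [sigma'_eq, ← qExp_eq]
  ring

/-- `E₂(-1/z) = z² E₂(z) + 6 z / (π i)`. -/
lemma E2_S (z w : ℍ) (h : (w : ℂ) = -1 / z) :
    E2 w = (z : ℂ) ^ 2 * E2 z + 6 * z / (Real.pi * Complex.I) := by
  have hz : (z : ℂ) ≠ 0 := ne_zero z
  have hp : (Real.pi : ℂ) ≠ 0 := by exact_mod_cast Real.pi_ne_zero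
  have h1 := EisensteinSeries.G2_S_transform z
  have hw : ModularGroup.S • z = w := by
    ext
    rw [h, modular_S_smul]
    simp [neg_div]
  rw [hw, G2_eq, G2_eq] at h1
  have hI : Complex.I ≠ 0 := I_ne_zero
  field_simp at h1 ⊢
  have hI2 : Complex.I ^ 2 = -1 := I_sq
  linear_combination (-Complex.I) * h1  + (-6 * z) * hI2

lemma summable_sigma (z : ℍ) : Summable fun n : ℕ+ => (sigma' 1 n : ℂ) * qExp z ^ (n : ℕ) := by
  have := EisensteinSeries.summable_sigma_mul_cexp_pow (k := 2) one_le_two z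
  simp only [sigma'_eq, ← qExp_eq]
  exact this.comp_injective PNat.coe_injective

lemma E2N_eq (N : ℕ) (z w : ℍ) (h : (w : ℂ) = N * z) : 24 * E2N N z = N * E2 w - E2 z := by
  have hq (n : ℕ) : qExp z ^ (N * n) = qExp w ^ n := by
    rw [pow_mul]; congr 1; rw [qExp, qExp, h, ← Complex.exp_nat_mul]; ring_nf
  rw [E2N, E2, E2]
  simp only [hq, mul_sub, mul_left_comm _ (N : ℂ)]
  rw [Summable.tsum_sub (summable_sigma z) ((summable_sigma w).mul_left _), tsum_mul_left]
  ring

open PeriodPair in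
lemma hasDerivAt_P (L : PeriodPair) (x : ℂ) (hx : x ∉ L.lattice) :
    HasDerivAt L.weierstrassP (L.derivWeierstrassP x) x := by
  have := (L.analyticOnNhd_weierstrassP x hx).differentiableAt.hasDerivAt
  rwa [L.deriv_weierstrassP] at this

lemma iteratedDeriv_P (L : PeriodPair) (x : ℂ) (hx : x ∉ L.lattice) (n : ℕ) (hn : n ≠ 0) :
    iteratedDeriv n L.weierstrassP x = (n + 1).factorial * L.sumInvPow x (n + 2) := by
  obtain ⟨r, h₁, h₂⟩ := Metric.nhds_basis_closedBall.mem_iff.mp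
    (L.isClosed_lattice.isOpen_compl.mem_nhds hx)
  have h := L.hasFPowerSeriesOnBall_weierstrassP x ⟨r, h₁.le⟩ h₁ h₂
  have h2 := h.hasFPowerSeriesAt.eq_formalMultilinearSeries
    (L.analyticOnNhd_weierstrassP x hx).hasFPowerSeriesAt
  have h3 := congrArg (fun p : FormalMultilinearSeries ℂ ℂ ℂ => p.coeff n) h2
  simp [PeriodPair.weierstrassPSeries, hn] at h3
  rw [eq_div_iff (by exact_mod_cast n.factorial_ne_zero)] at h3
  rw [← h3, Nat.factorial_succ]
  push_cast; ring

section ode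
variable (L : PeriodPair)

lemma isPreconnected_U : IsPreconnected ((L.lattice : Set ℂ)ᶜ) := by
  refine (Set.Countable.isConnected_compl_of_one_lt_rank ?_ ?_).isPreconnected
  · simp
  · exact (countable_of_Lindelof_of_discrete (X := L.lattice)).to_set

lemma derivP_not_zero : ¬ ∀ x ∈ ((L.lattice : Set ℂ)ᶜ), L.derivWeierstrassP x = 0 := by
  intro h
  have hU : IsOpen ((L.lattice : Set ℂ)ᶜ) := L.isClosed_lattice.isOpen_compl
  obtain ⟨a, ha⟩ := hU.exists_is_const_of_deriv_eq_zero (isPreconnected_U L)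
    L.differentiableOn_weierstrassP (fun x hx => by simpa using h x hx)
  have h1 : L.weierstrassP =ᶠ[nhdsWithin 0 {0}ᶜ] fun _ => a := by
    have := mem_nhdsWithin_of_mem_nhds (t := {0}ᶜ) (L.compl_lattice_sdiff_singleton_mem_nhds 0)
    filter_upwards [this, self_mem_nhdsWithin] with x hx hx0
    refine ha x ?_
    intro hl
    exact hx ⟨hl, hx0⟩
  have h2 := meromorphicOrderAt_congr h1
  rw [L.order_weierstrassP 0 (zero_mem _), meromorphicOrderAt_const] at h2
  split_ifs at h2
  · exact absurd h2 (WithTop.coe_ne_top (a := (-2 : ℤ)))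
  · exact absurd (WithTop.coe_injective (a₁ := (-2 : ℤ)) (a₂ := 0) h2) (by decide)

lemma deriv2_P (x : ℂ) (hx : x ∉ L.lattice) :
    deriv L.derivWeierstrassP x = 6 * L.weierstrassP x ^ 2 - L.g₂ / 2 := by
  have hU : IsOpen ((L.lattice : Set ℂ)ᶜ) := L.isClosed_lattice.isOpen_compl
  have ha := L.analyticOnNhd_derivWeierstrassP
  have hp := L.analyticOnNhd_weierstrassP
  have hb : AnalyticOnNhd ℂ (fun y => 2 * deriv L.derivWeierstrassP y
      - 12 * L.weierstrassP y ^ 2 + L.g₂) ((L.lattice : Set ℂ)ᶜ) :=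
    ((analyticOnNhd_const.mul ha.deriv).sub (analyticOnNhd_const.mul (hp.pow 2))).add
      analyticOnNhd_const
  have key := AnalyticOnNhd.eq_zero_or_eq_zero_of_mul_eq_zero ha hb ?_ (isPreconnected_U L)
  · rcases key with h | h
    · exact absurd h (derivP_not_zero L)
    · have := h x hx
      linear_combination this / 2
  · intro y hy
    have e : (fun z => L.derivWeierstrassP z ^ 2) =ᶠ[nhds y]
        fun z => 4 * L.weierstrassP z ^ 3 - L.g₂ * L.weierstrassP z - L.g₃ := by
      filter_upwards [hU.mem_nhds hy] with z hz using L.derivWeierstrassP_sq z hz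
    have hd := (ha y hy).differentiableAt.hasDerivAt
    have hP := hasDerivAt_P L y hy
    have e1 : HasDerivAt (fun z => L.derivWeierstrassP z ^ 2) _ y := hd.pow 2
    have e2 : HasDerivAt (fun z => 4 * L.weierstrassP z ^ 3 - L.g₂ * L.weierstrassP z - L.g₃) _ y :=
      ((hP.pow 3).const_mul 4).sub (hP.const_mul L.g₂) |>.sub_const L.g₃
    have := (e1.congr_of_eventuallyEq e.symm).unique e2
    push_cast at this
    linear_combination this

lemma iter_succ (n : ℕ) (F G : ℂ → ℂ)
    (h : ∀ x ∉ L.lattice, iteratedDeriv n L.weierstrassP x = F x)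
    (hF : ∀ x ∉ L.lattice, HasDerivAt F (G x) x) :
    ∀ x ∉ L.lattice, iteratedDeriv (n + 1) L.weierstrassP x = G x := by
  intro x hx
  have hU : IsOpen ((L.lattice : Set ℂ)ᶜ) := L.isClosed_lattice.isOpen_compl
  have e : iteratedDeriv n L.weierstrassP =ᶠ[nhds x] F := by
    filter_upwards [hU.mem_nhds hx] with z hz using h z hz
  rw [iteratedDeriv_succ, e.deriv_eq, (hF x hx).deriv]

lemma iter_P (x : ℂ) (hx : x ∉ L.lattice) :
    iteratedDeriv 2 L.weierstrassP x = 6 * L.weierstrassP x ^ 2 - L.g₂ / 2 ∧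
    iteratedDeriv 4 L.weierstrassP x =
      120 * L.weierstrassP x ^ 3 - 18 * L.g₂ * L.weierstrassP x - 12 * L.g₃ ∧
    iteratedDeriv 6 L.weierstrassP x = 5040 * L.weierstrassP x ^ 4
      - 1008 * L.g₂ * L.weierstrassP x ^ 2 - 720 * L.g₃ * L.weierstrassP x + 9 * L.g₂ ^ 2 := by
  have hP := fun y hy => hasDerivAt_P L y hy
  have hQ : ∀ y ∉ L.lattice, HasDerivAt L.derivWeierstrassP
      (6 * L.weierstrassP y ^ 2 - L.g₂ / 2) y := fun y hy => by
    rw [← deriv2_P L y hy]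
    exact (L.analyticOnNhd_derivWeierstrassP y hy).differentiableAt.hasDerivAt
  have hS := fun y hy => L.derivWeierstrassP_sq y hy
  have h1 : ∀ y ∉ L.lattice, iteratedDeriv 1 L.weierstrassP y = L.derivWeierstrassP y := by
    intro y hy; rw [iteratedDeriv_one, L.deriv_weierstrassP]
  have h2 := iter_succ L 1 _ _ h1 hQ
  have h3 := iter_succ L 2 _ (fun y => 12 * L.weierstrassP y * L.derivWeierstrassP y) h2 (by
    intro y hy
    refine HasDerivAt.congr_deriv ((((hP y hy).pow 2).const_mul 6).sub_const (L.g₂ / 2)) ?_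
    push_cast; ring)
  have h4 := iter_succ L 3 _ (fun y => 120 * L.weierstrassP y ^ 3 - 18 * L.g₂ * L.weierstrassP y
      - 12 * L.g₃) h3 (by
    intro y hy
    refine HasDerivAt.congr_deriv (((hP y hy).const_mul 12).mul (hQ y hy)) ?_
    linear_combination 12 * hS y hy)
  have h5 := iter_succ L 4 _ (fun y => (360 * L.weierstrassP y ^ 2 - 18 * L.g₂)
      * L.derivWeierstrassP y) h4 (by
    intro y hy
    refine HasDerivAt.congr_deriv (((((hP y hy).pow 3).const_mul 120).sub ((hP y hy).const_mul (18 * L.g₂))).sub_const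
      (12 * L.g₃)) ?_
    push_cast; ring)
  have h6 := iter_succ L 5 _ (fun y => 5040 * L.weierstrassP y ^ 4
      - 1008 * L.g₂ * L.weierstrassP y ^ 2 - 720 * L.g₃ * L.weierstrassP y + 9 * L.g₂ ^ 2) h5 (by
    intro y hy
    refine HasDerivAt.congr_deriv (((((hP y hy).pow 2).const_mul 360).sub_const (18 * L.g₂)).mul (hQ y hy)) ?_
    push_cast
    simp only [Pi.pow_apply]
    linear_combination (720 * L.weierstrassP y) * hS y hy)
  exact ⟨h2 x hx, h4 x hx, h6 x hx⟩

end ode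

noncomputable def Lz (z : ℍ) : PeriodPair where
  ω₁ := 1
  ω₂ := z
  indep := by
    rw [LinearIndependent.pair_iff]
    intro s t h
    have him := congrArg Complex.im h
    simp at him
    have ht : t = 0 := by
      rcases him with h | h
      · exact h
      · exact absurd h z.im_ne_zero
    subst ht
    have hre := congrArg Complex.re h
    simp at hre
    exact ⟨hre, rfl⟩

lemma Lz_symm (z : ℍ) (p : ℤ × ℤ) :
    (((Lz z).latticeEquivProd.symm p : (Lz z).lattice) : ℂ) = p.1 + p.2 * z := by
  rw [(Lz z).latticeEquiv_symm_apply]; simp [Lz]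

lemma hasSum_lattice (z : ℍ) (f : ℂ → ℂ) (S : ℂ) (h : HasSum (fun l : (Lz z).lattice => f l) S) :
    HasSum (fun p : ℤ × ℤ => f (p.1 + p.2 * z)) S := by
  have := ((Lz z).latticeEquivProd.symm.toEquiv.hasSum_iff).mpr h
  refine this.congr_fun ?_
  intro p
  simp [Lz_symm]

lemma hasSum_fib {α γ : Type*} (e : α × Fin 5 ≃ γ) (g : γ → ℂ) (S : ℂ) (h : HasSum g S) :
    HasSum (fun a => ∑ j : Fin 5, g (e (a, j))) S := by
  have h1 := e.hasSum_iff.mpr h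
  exact h1.prod_fiberwise (fun a => hasSum_fintype _)

def e5 : (ℤ × Fin 5) ≃ ℤ := (Int.divModEquiv 5).symm

lemma e5_apply (a : ℤ) (j : Fin 5) : e5 (a, j) = 5 * a + (j : ℕ) := by
  simp [e5, Int.divModEquiv, mul_comm]

def e5' : ((ℤ × ℤ) × Fin 5) ≃ (ℤ × ℤ) where
  toFun p := (e5 (p.1.1, p.2), p.1.2)
  invFun p := (((e5.symm p.1).1, p.2), (e5.symm p.1).2)
  left_inv p := by simp
  right_inv p := by simp

def eFin : (ℤ × ℤ) ≃ (Fin 2 → ℤ) where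
  toFun p := ![p.2, p.1]
  invFun v := (v 1, v 0)
  left_inv p := by simp
  right_inv v := by ext i; fin_cases i <;> simp

lemma hasSum_Gz (k : ℕ) (hk : 3 ≤ k) (z : ℍ) :
    HasSum (fun p : ℤ × ℤ => (((p.1 : ℂ) + p.2 * z) ^ k)⁻¹) (Gz k z) := by
  have h : Summable (fun v => EisensteinSeries.eisSummand k v z) :=
    (EisensteinSeries.summable_norm_eisSummand (by exact_mod_cast hk) z).of_norm
  have := eFin.hasSum_iff.mpr h.hasSum
  refine this.congr_fun ?_
  intro p
  simp [EisensteinSeries.eisSummand, eFin, add_comm]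

lemma G_eq (k : ℕ) (hk : 3 ≤ k) (z : ℍ) : (Lz z).G k = Gz k z := by
  rw [← PeriodPair.sumInvPow_zero]
  refine (hasSum_lattice z (fun l => ((l - 0) ^ k)⁻¹) _
    ((Lz z).hasSum_sumInvPow 0 (r := k) hk)).unique ?_
  simpa using hasSum_Gz k hk z

lemma hasSum_inv (k : ℕ) (hk : 3 ≤ k) (z : ℍ) (x : ℂ) :
    HasSum (fun p : ℤ × ℤ => (((p.1 : ℂ) + p.2 * z - x) ^ k)⁻¹) ((Lz z).sumInvPow x k) :=
  hasSum_lattice z (fun l => ((l - x) ^ k)⁻¹) _ ((Lz z).hasSum_sumInvPow x (r := k) hk)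

lemma hasSum_P (z : ℍ) (x : ℂ) :
    HasSum (fun p : ℤ × ℤ => 1 / (x - ((p.1 : ℂ) + p.2 * z)) ^ 2 - 1 / ((p.1 : ℂ) + p.2 * z) ^ 2)
      ((Lz z).weierstrassP x) :=
  hasSum_lattice z (fun l => 1 / (x - l) ^ 2 - 1 / l ^ 2) _ ((Lz z).hasSum_weierstrassP x)

lemma torsion_sum (k : ℕ) (hk : 3 ≤ k) (z w : ℍ) (hw : (w : ℂ) = 5 * z) :
    ∑ j : Fin 5, (Lz z).sumInvPow (-(((j : ℕ) : ℂ) / 5)) k = 5 ^ k * Gz k w := by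
  have h1 := (hasSum_fib e5' _ _ (hasSum_Gz k hk w)).mul_left ((5 : ℂ) ^ k)
  have h2 := hasSum_sum (s := (Finset.univ : Finset (Fin 5))) (fun (j : Fin 5) _ => hasSum_inv k hk z (-(((j : ℕ) : ℂ) / 5)))
  refine h2.unique (h1.congr_fun ?_)
  rintro ⟨a, b⟩
  rw [Finset.mul_sum]
  refine Finset.sum_congr rfl fun j _ => ?_
  simp only [e5', Equiv.coe_fn_mk, e5_apply, hw]
  push_cast
  rw [show (5 * (a : ℂ) + (j : ℕ) + b * (5 * z)) = 5 * (a + b * z - -(((j : ℕ) : ℂ) / 5)) by ring,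
    mul_pow, mul_inv, mul_inv_cancel_left₀ (pow_ne_zero _ (by norm_num))]

lemma P_sum (z w : ℍ) (hw : (w : ℂ) = 5 * z) :
    ∑ j : Fin 5, (Lz z).weierstrassP (-(((j : ℕ) : ℂ) / 5)) =
      25 * EisensteinSeries.G2 w - 5 * EisensteinSeries.G2 z := by
  have h2 := hasSum_sum (s := (Finset.univ : Finset (Fin 5))) (fun (j : Fin 5) _ => hasSum_P z (-(((j : ℕ) : ℂ) / 5)))
  have h3 := (Equiv.prodComm ℤ ℤ).hasSum_iff.mpr h2
  have row : ∀ b : ℤ, HasSum (fun a : ℤ => ∑ j : Fin 5,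
      (1 / (-(((j : ℕ) : ℂ) / 5) - (a + b * z)) ^ 2 - 1 / ((a : ℂ) + b * z) ^ 2))
      (25 * EisensteinSeries.e2Summand b w - 5 * EisensteinSeries.e2Summand b z) := by
    intro b
    have g1 := (hasSum_fib e5 _ _ (EisensteinSeries.e2Summand_summable b w).hasSum).mul_left 25
    have g2 := (EisensteinSeries.e2Summand_summable b z).hasSum.mul_left 5
    refine (g1.sub g2).congr_fun ?_
    intro a
    rw [Finset.sum_sub_distrib, Finset.mul_sum]
    congr 1
    · refine Finset.sum_congr rfl fun j _ => ?_
      simp only [EisensteinSeries.eisSummand, e5_apply, hw]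
      simp
      rw [show ((b : ℂ) * (5 * (z : ℂ)) + (5 * (a : ℂ) + ((j : ℕ) : ℂ))) =
        (-5) * (-(((j : ℕ) : ℂ) / 5) - ((a : ℂ) + (b : ℂ) * (z : ℂ))) by ring, mul_pow, mul_inv]
      norm_num
      ring
    · simp [EisensteinSeries.eisSummand, add_comm, zpow_ofNat]
  have h4 := h3.prod_fiberwise (fun b => by simpa using row b)
  have h5 : ∑' b, (25 * EisensteinSeries.e2Summand b w - 5 * EisensteinSeries.e2Summand b z) =
      ∑'[SummationFilter.symmetricIcc ℤ] b,
        (25 * EisensteinSeries.e2Summand b w - 5 * EisensteinSeries.e2Summand b z) :=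
    (tsum_eq_of_summable_unconditional h4.summable).symm
  rw [← h4.tsum_eq, h5, Summable.tsum_sub, tsum_mul_left, tsum_mul_left]
  · rfl
  · exact (EisensteinSeries.summable_e2Summand_symmetricIcc w).mul_left _
  · exact (EisensteinSeries.summable_e2Summand_symmetricIcc z).mul_left _

lemma not_mem_lat (z : ℍ) (j : ℕ) (h1 : 1 ≤ j) (h4 : j ≤ 4) :
    -((j : ℂ) / 5) ∉ (Lz z).lattice := by
  intro h
  obtain ⟨m, n, h⟩ := PeriodPair.mem_lattice.mp h
  simp only [Lz, mul_one] at h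
  have him := congrArg Complex.im h
  have hj : ((j : ℂ) / 5) = (((j : ℝ) / 5 : ℝ) : ℂ) := by push_cast; rfl
  rw [hj] at him h
  simp [-ofReal_div] at him
  have hn : n = 0 := by
    rcases him with h | h
    · exact h
    · exact absurd h z.im_ne_zero
  subst hn
  have hre := congrArg Complex.re h
  simp [-ofReal_div] at hre
  have : 5 * (m : ℝ) = - (j : ℝ) := by rw [hre]; ring
  have : 5 * m = - (j : ℤ) := by exact_mod_cast this
  omega

lemma P_sym (z : ℍ) (x y : ℂ) (h : x + y = -1) :
    (Lz z).weierstrassP x = (Lz z).weierstrassP y := by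
  have h1 : (1 : ℂ) ∈ (Lz z).lattice := (Lz z).ω₁_mem_lattice
  have := (Lz z).weierstrassP_add_coe y ⟨1, h1⟩
  rw [← this, ← (Lz z).weierstrassP_neg]
  congr 1
  simp only
  linear_combination (-1) * h

lemma five_rel (z w : ℍ) (hw : (w : ℂ) = 5 * z) : ∃ x y : ℂ,
    2 * (x + y) = 25 * EisensteinSeries.G2 w - 5 * EisensteinSeries.G2 z ∧
    2 * (6 * (x ^ 2 + y ^ 2) - 60 * Gz 4 z) = 6 * (5 ^ 4 * Gz 4 w - Gz 4 z) ∧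
    2 * (120 * (x ^ 3 + y ^ 3) - 18 * (60 * Gz 4 z) * (x + y) - 24 * (140 * Gz 6 z)) =
      120 * (5 ^ 6 * Gz 6 w - Gz 6 z) ∧
    2 * (5040 * (x ^ 4 + y ^ 4) - 1008 * (60 * Gz 4 z) * (x ^ 2 + y ^ 2)
      - 720 * (140 * Gz 6 z) * (x + y) + 18 * (60 * Gz 4 z) ^ 2) =
      5040 * (5 ^ 8 * Gz 8 w - Gz 8 z) := by
  set p : ℕ → ℂ := fun j => -((j : ℂ) / 5) with hp
  have hg2 : (Lz z).g₂ = 60 * Gz 4 z := by rw [PeriodPair.g₂, G_eq 4 (by norm_num)]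
  have hg3 : (Lz z).g₃ = 140 * Gz 6 z := by rw [PeriodPair.g₃, G_eq 6 (by norm_num)]
  have s14 : (Lz z).weierstrassP (p 4) = (Lz z).weierstrassP (p 1) :=
    P_sym z _ _ (by simp [hp]; norm_num)
  have s23 : (Lz z).weierstrassP (p 3) = (Lz z).weierstrassP (p 2) :=
    P_sym z _ _ (by simp [hp]; norm_num)
  have hi : ∀ j, 1 ≤ j → j ≤ 4 →
      6 * (Lz z).sumInvPow (p j) 4 = 6 * (Lz z).weierstrassP (p j) ^ 2 - (60 * Gz 4 z) / 2 ∧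
      120 * (Lz z).sumInvPow (p j) 6 = 120 * (Lz z).weierstrassP (p j) ^ 3
        - 18 * (60 * Gz 4 z) * (Lz z).weierstrassP (p j) - 12 * (140 * Gz 6 z) ∧
      5040 * (Lz z).sumInvPow (p j) 8 = 5040 * (Lz z).weierstrassP (p j) ^ 4
        - 1008 * (60 * Gz 4 z) * (Lz z).weierstrassP (p j) ^ 2
        - 720 * (140 * Gz 6 z) * (Lz z).weierstrassP (p j) + 9 * (60 * Gz 4 z) ^ 2 := by
    intro j h1 h4
    have hn := not_mem_lat z j h1 h4
    have h := iter_P (Lz z) (p j) hn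
    rw [iteratedDeriv_P _ _ hn 2 (by norm_num), iteratedDeriv_P _ _ hn 4 (by norm_num),
      iteratedDeriv_P _ _ hn 6 (by norm_num), hg2, hg3] at h
    norm_num [Nat.factorial] at h
    exact h
  have t (k : ℕ) (hk : 3 ≤ k) : (Lz z).sumInvPow (p 1) k + (Lz z).sumInvPow (p 2) k
      + (Lz z).sumInvPow (p 3) k + (Lz z).sumInvPow (p 4) k = 5 ^ k * Gz k w - Gz k z := by
    rw [← torsion_sum k hk z w hw, ← G_eq k hk z, ← PeriodPair.sumInvPow_zero,
      Fin.sum_univ_five]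
    simp [hp]
    ring
  have t4 := t 4 (by norm_num)
  have t6 := t 6 (by norm_num)
  have t8 := t 8 (by norm_num)
  have hP := P_sum z w hw
  rw [Fin.sum_univ_five] at hP
  have hP' : (Lz z).weierstrassP (p 1) + (Lz z).weierstrassP (p 2)
      + (Lz z).weierstrassP (p 3) + (Lz z).weierstrassP (p 4) =
      25 * EisensteinSeries.G2 w - 5 * EisensteinSeries.G2 z := by
    rw [← hP]; simp [hp]
  obtain ⟨a1, b1, c1⟩ := hi 1 (by norm_num) (by norm_num)
  obtain ⟨a2, b2, c2⟩ := hi 2 (by norm_num) (by norm_num)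
  obtain ⟨a3, b3, c3⟩ := hi 3 (by norm_num) (by norm_num)
  obtain ⟨a4, b4, c4⟩ := hi 4 (by norm_num) (by norm_num)
  rw [s23] at a3 b3 c3
  rw [s14] at a4 b4 c4
  rw [s23, s14] at hP'
  refine ⟨(Lz z).weierstrassP (p 1), (Lz z).weierstrassP (p 2), ?_, ?_, ?_, ?_⟩
  · linear_combination hP'
  · linear_combination 6 * t4 - a1 - a2 - a3 - a4
  · linear_combination 120 * t6 - b1 - b2 - b3 - b4
  · linear_combination 5040 * t8 - c1 - c2 - c3 - c4

lemma alg5 (e x y A B : ℂ) (he : e ^ 2 = e - 5)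
    (h4 : 2 * (6 * (x ^ 2 + y ^ 2) - 60 * A) = 6 * (e ^ 4 * A - A))
    (h6 : 2 * (120 * (x ^ 3 + y ^ 3) - 18 * (60 * A) * (x + y) - 24 * (140 * B)) =
      120 * (e ^ 6 * B - B))
    (h8 : 2 * (5040 * (x ^ 4 + y ^ 4) - 1008 * (60 * A) * (x ^ 2 + y ^ 2)
      - 720 * (140 * B) * (x + y) + 18 * (60 * A) ^ 2) =
      5040 * (e ^ 8 * (3 / 7 * A ^ 2) - 3 / 7 * A ^ 2)) :
    B = (-27 / 280 - 81 / 560 * e) * (x + y) * A + (-1 / 280 + 1 / 280 * e) * (x + y) ^ 3 ∧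
    (A - (8 / 375 + 2 / 375 * e) * (x + y) ^ 2) * (A - (38 / 375 + 22 / 375 * e) * (x + y) ^ 2)
      = 0 := by
  have e3 : e ^ 3 = -4 * e - 5 := by linear_combination (e + 1) * he
  have e4 : e ^ 4 = -9 * e + 20 := by linear_combination e * e3 - 4 * he
  have e6 : e ^ 6 = 56 * e - 55 := by
    rw [show e ^ 6 = e ^ 3 * e ^ 3 by ring, e3]; linear_combination 16 * he
  have e8 : e ^ 8 = -279 * e - 5 := by
    rw [show e ^ 8 = e ^ 4 * e ^ 4 by ring, e4]; linear_combination 81 * he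
  rw [e4] at h4
  rw [e6] at h6
  rw [e8] at h8
  have k2 : x ^ 2 + y ^ 2 = (39 / 2 - 9 / 2 * e) * A := by linear_combination h4 / 12
  have n3 : x ^ 3 + y ^ 3 = (x + y) * (3 * (x ^ 2 + y ^ 2) - (x + y) ^ 2) / 2 := by ring
  have n4 : x ^ 4 + y ^ 4 = (x + y) * (x ^ 3 + y ^ 3)
      - ((x + y) ^ 2 - (x ^ 2 + y ^ 2)) / 2 * (x ^ 2 + y ^ 2) := by ring
  rw [n4, n3, k2] at h8
  rw [n3, k2] at h6
  generalize x + y = s at h6 h8 ⊢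
  have hB : B = (-27 / 280 - 81 / 560 * e) * s * A + (-1 / 280 + 1 / 280 * e) * s ^ 3 := by
    linear_combination (-(1 - e) / 140 / 240) * h6 + (B / 5 + 27 / 560 * s * A) * he
  refine ⟨hB, ?_⟩
  rw [hB] at h8
  have hq : (1125 / 14 - 2025 / 56 * e) * A ^ 2 + (-150 / 7 + 45 / 28 * e) * s ^ 2 * A
      + (3 / 7 + 1 / 14 * e) * s ^ 4 = 0 := by
    linear_combination (-1 / 10080) * h8 + (81 / 8) * A ^ 2 * he
  linear_combination (616 / 140625 + 56 / 15625 * e) * hq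
    + (81 / 625 * A ^ 2 - 18 / 3125 * s ^ 2 * A + 8 / 140625 * s ^ 4) * he

lemma sigma_bound (k : ℕ) (q : ℂ) (x : ℝ) (hx : 2 ^ (k + 1) * ‖q‖ ≤ x) (hx1 : x < 1) :
    ‖∑' n : ℕ+, (sigma' k n : ℂ) * q ^ (n : ℕ)‖ ≤ x * (1 - x)⁻¹ := by
  have hx0 : 0 ≤ x := le_trans (by positivity) hx
  have h1 : HasSum (fun n : ℕ => x * x ^ n) (x * (1 - x)⁻¹) :=
    (hasSum_geometric_of_lt_one hx0 hx1).mul_left x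
  have h2 := Equiv.pnatEquivNat.hasSum_iff.mpr h1
  refine tsum_of_norm_bounded h2 ?_
  intro n
  have hs : sigma' k n ≤ (n : ℕ) ^ (k + 1) := by
    rw [sigma'_eq]; exact ArithmeticFunction.sigma_le_pow_succ k n
  have hn : (n : ℕ) ^ (k + 1) ≤ (2 ^ (k + 1)) ^ (n : ℕ) := by
    rw [← pow_mul, mul_comm, pow_mul]
    exact Nat.pow_le_pow_left (Nat.lt_two_pow_self).le _
  have hsr : (sigma' k n : ℝ) ≤ (2 ^ (k + 1)) ^ (n : ℕ) := by exact_mod_cast hs.trans hn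
  rw [norm_mul, norm_pow, Complex.norm_natCast]
  calc (sigma' k n : ℝ) * ‖q‖ ^ (n : ℕ) ≤ (2 ^ (k + 1)) ^ (n : ℕ) * ‖q‖ ^ (n : ℕ) := by gcongr
    _ = (2 ^ (k + 1) * ‖q‖) ^ (n : ℕ) := by rw [mul_pow]
    _ ≤ x ^ (n : ℕ) := by gcongr
    _ = _ := by
      simp only [Function.comp, Equiv.pnatEquivNat_apply]
      rw [← pow_succ', PNat.natPred_add_one]

lemma qExp_norm (z : ℂ) (h : 13 ≤ 2 * Real.pi * z.im) : ‖qExp z‖ ≤ 1 / 400000 := by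
  rw [qExp, Complex.norm_exp]
  have : (2 * Real.pi * Complex.I * z).re = -(2 * Real.pi * z.im) := by
    simp [Complex.mul_re]
  rw [this, Real.exp_neg, one_div]
  gcongr
  calc (400000 : ℝ) ≤ 2.718 ^ 13 := by norm_num
    _ ≤ Real.exp 1 ^ 13 := by gcongr; exact (by norm_num : (2.718 : ℝ) ≤ 2.7182818283).trans Real.exp_one_gt_d9.le
    _ = Real.exp 13 := by rw [← Real.exp_nat_mul]; norm_num
    _ ≤ _ := Real.exp_le_exp.mpr h

lemma E4_near (z : ℂ) (h : 13 ≤ 2 * Real.pi * z.im) : ‖E4 z - 1‖ ≤ 1 / 100 := by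
  have hq := qExp_norm z h
  have := sigma_bound 3 (qExp z) (16 / 400000) (by norm_num; linarith) (by norm_num)
  rw [E4, add_sub_cancel_left, norm_mul]
  norm_num at this ⊢
  linarith

lemma E6_near (z : ℂ) (h : 13 ≤ 2 * Real.pi * z.im) : ‖E6 z - 1‖ ≤ 1 / 10 := by
  have hq := qExp_norm z h
  have := sigma_bound 5 (qExp z) (64 / 400000) (by norm_num; linarith) (by norm_num)
  rw [E6, sub_sub_cancel_left, norm_neg, norm_mul]
  norm_num at this ⊢
  linarith

/-- If `a ≈ 1`, `b ≈ 1` then `b² ≠ d a³` for `d` far from `1`. -/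
lemma near_contra (a b d : ℂ) (ha : ‖a - 1‖ ≤ 1 / 100) (hb : ‖b - 1‖ ≤ 1 / 10)
    (hd : ‖d‖ ≤ 2) (hd1 : 1 / 2 ≤ ‖d - 1‖) (h : b ^ 2 = d * a ^ 3) : False := by
  set u := a - 1
  set v := b - 1
  have hau : a = 1 + u := by simp [u]
  have hbv : b = 1 + v := by simp [v]
  have key : d - 1 = (2 * v + v * v) - d * (3 * u + 3 * (u * u) + u * u * u) := by
    rw [hau, hbv] at h
    linear_combination (-1) * h
  have h1 : ‖2 * v + v * v‖ ≤ 21 / 100 := by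
    refine (norm_add_le _ _).trans ?_
    rw [norm_mul, norm_mul]
    norm_num
    nlinarith [norm_nonneg v]
  have h2 : ‖3 * u + 3 * (u * u) + u * u * u‖ ≤ 4 / 100 := by
    refine (norm_add₃_le).trans ?_
    simp only [norm_mul]
    norm_num
    have h0 := norm_nonneg u
    have h3 : ‖u‖ * ‖u‖ ≤ 1 / 10000 := by nlinarith
    nlinarith
  have h3 : ‖d * (3 * u + 3 * (u * u) + u * u * u)‖ ≤ 2 * (4 / 100) := by
    rw [norm_mul]; gcongr
  have := norm_sub_le (2 * v + v * v) (d * (3 * u + 3 * (u * u) + u * u * u))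
  rw [← key] at this
  linarith

lemma spurious (e s A B : ℂ) (he : e ^ 2 = e - 5)
    (hA : A = (38 / 375 + 22 / 375 * e) * s ^ 2)
    (hB : B = (-27 / 280 - 81 / 560 * e) * s * A + (-1 / 280 + 1 / 280 * e) * s ^ 3) :
    49 / 20 * B ^ 2 = (-15781149/212629504 + 127008027/212629504 * e) * A ^ 3 := by
  have hB' : B = (509/17500 - 883/35000 * e) * s ^ 3 := by
    rw [hB, hA]; linear_combination (-(81 * 22) / (560 * 375)) * s ^ 3 * he
  have b2 : B ^ 2 = ((-2862121 / 1225000000) + (-1018099 / 1225000000) * e) * s ^ 6 := by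
    rw [hB']; linear_combination (883/35000) ^ 2 * s ^ 6 * he
  have a2 : A ^ 2 = ((-976 / 140625) + (2156 / 140625) * e) * s ^ 4 := by
    rw [hA]; linear_combination (22 / 375) ^ 2 * s ^ 4 * he
  have a3 : A ^ 3 = ((-30472 / 5859375) + (107888 / 52734375) * e) * s ^ 6 := by
    rw [show A ^ 3 = A ^ 2 * A by ring, a2, hA]; linear_combination (22 / 375) * (2156 / 140625) * s ^ 6 * he
  rw [b2, a3]
  linear_combination (-(127008027/212629504) * (107888 / 52734375)) * s ^ 6 * he

lemma exists_UHP (z : ℂ) (h : 0 < z.im) : ∃ w : ℍ, (w : ℂ) = z := ⟨⟨z, h⟩, rfl⟩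

lemma re_lin (a b : ℝ) (w : ℂ) : ((a : ℂ) + b * (1 - w)).re = a + b * (1 - w.re) := by
  simp

lemma im_lin (a b : ℝ) (w : ℂ) : ((a : ℂ) + b * (1 - w)).im = b * (-w.im) := by
  simp

lemma heegner_core (r : ℂ) (hr : r = Complex.I * (Real.sqrt 19 : ℂ)) :
    ∃ Y : ℂ, E2N 19 ((-19 + r) / 38) = 19 / 12 * Y ∧ Y ≠ 0 ∧
      E4 (19 * ((-19 + r) / 38)) = 19 / 6 * Y ^ 2 ∧
      E6 (19 * ((-19 + r) / 38)) = 361 / 64 * Y ^ 3 := by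
  have h19 : (Real.sqrt 19) ^ 2 = 19 := Real.sq_sqrt (by norm_num)
  have hs4 : 4.2 ≤ Real.sqrt 19 := Real.le_sqrt_of_sq_le (by norm_num)
  have hs5 : Real.sqrt 19 ≤ 4.4 := (Real.sqrt_le_left (by norm_num)).mpr (by norm_num)
  have hr2 : r ^ 2 = -19 := by
    rw [hr, mul_pow, I_sq, ← ofReal_pow, h19]; norm_num
  have hrim : r.im = Real.sqrt 19 := by rw [hr]; simp
  have hrre : r.re = 0 := by rw [hr]; simp
  have hr0 : r ≠ 0 := by intro h; rw [h] at hr2; norm_num at hr2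
  have hpi : (Real.pi : ℂ) ≠ 0 := by exact_mod_cast Real.pi_ne_zero
  obtain ⟨om, hom⟩ := exists_UHP ((1 + r) / 2) (by simp [hrim])
  obtain ⟨zz, hzz⟩ := exists_UHP ((r - 1) / 10) (by simp [hrim])
  obtain ⟨ww, hww⟩ := exists_UHP ((r - 1) / 2) (by simp [hrim])
  obtain ⟨tt, htt⟩ := exists_UHP ((-19 + r) / 38) (by simp [hrim])
  obtain ⟨vv, hvv⟩ := exists_UHP ((r - 1) / 10 + (2 : ℤ)) (by simp [hrim])
  obtain ⟨uu, huu⟩ := exists_UHP (19 * ((-19 + r) / 38)) (by simp [hrim])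
  have om0 : (om : ℂ) ≠ 0 := ne_zero om
  have tt0 : (tt : ℂ) ≠ 0 := ne_zero tt
  have h13 : 13 ≤ 2 * Real.pi * (om : ℂ).im := by
    have : (om : ℂ).im = Real.sqrt 19 / 2 := by rw [hom]; simp [hrim]
    rw [this]
    nlinarith [Real.pi_gt_d2]
  have zz_om : (zz : ℂ) = -1 / om := by
    rw [eq_div_iff om0, hzz, hom]; linear_combination hr2 / 20
  have ww_om : (ww : ℂ) = om + ((-1 : ℤ) : ℂ) := by rw [hww, hom]; push_cast; ring
  have uu_om : (uu : ℂ) = om + ((-10 : ℤ) : ℂ) := by rw [huu, hom]; push_cast; ring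
  have vv_zz : (vv : ℂ) = zz + ((2 : ℤ) : ℂ) := by rw [hvv, hzz]
  have vv_tt : (vv : ℂ) = -1 / tt := by
    rw [eq_div_iff tt0, hvv, htt]; push_cast; linear_combination hr2 / 380
  have ww_zz : (ww : ℂ) = 5 * zz := by rw [hww, hzz]; ring
  -- abbreviations
  set w : ℂ := (om : ℂ) with hw
  have hrw : r = 2 * w - 1 := by rw [hom]; ring
  have w2 : w ^ 2 = w - 5 := by rw [hom]; linear_combination hr2 / 4
  have w3 : w ^ 3 = -4 * w - 5 := by linear_combination (w + 1) * w2
  have w4 : w ^ 4 = -9 * w + 20 := by linear_combination w * w3 - 4 * w2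
  have w6 : w ^ 6 = 56 * w - 55 := by
    rw [show w ^ 6 = w ^ 3 * w ^ 3 by ring, w3]; linear_combination 16 * w2
  have he : (1 - w) ^ 2 = (1 - w) - 5 := by linear_combination w2
  -- Eisenstein values
  have g4 : Gz 4 ww = Gz 4 om := by rw [Gz_four, Gz_four, ww_om, E4_add_int]
  have g6 : Gz 6 ww = Gz 6 om := by rw [Gz_six, Gz_six, ww_om, E6_add_int]
  have s4 := Gz_S 4 om zz zz_om
  have s6 := Gz_S 6 om zz zz_om
  have q4 : (5 : ℂ) ^ 4 * Gz 4 ww = (1 - w) ^ 4 * Gz 4 zz := by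
    rw [g4, s4, ← hw, show (5 : ℂ) = (1 - w) * w by linear_combination w2]; ring
  have q6 : (5 : ℂ) ^ 6 * Gz 6 ww = (1 - w) ^ 6 * Gz 6 zz := by
    rw [g6, s6, ← hw, show (5 : ℂ) = (1 - w) * w by linear_combination w2]; ring
  have q8 : (5 : ℂ) ^ 8 * Gz 8 ww = (1 - w) ^ 8 * (3 / 7 * Gz 4 zz ^ 2) := by
    rw [Gz_eight]; linear_combination (3 / 7) * (5 ^ 4 * Gz 4 ww + (1 - w) ^ 4 * Gz 4 zz) * q4
  have A_eq : Gz 4 zz = w ^ 4 * ((Real.pi : ℂ) ^ 4 / 45 * E4 w) := by rw [s4, Gz_four]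
  have B_eq : Gz 6 zz = w ^ 6 * (2 * (Real.pi : ℂ) ^ 6 / 945 * E6 w) := by rw [s6, Gz_six]
  -- weight two
  set c : ℂ := 6 / (Real.pi * Complex.I) with hc
  have e2z : E2 zz = w ^ 2 * E2 w + c * w := by
    rw [E2_S om zz zz_om, hc]; ring
  have e2v : E2 vv = (tt : ℂ) ^ 2 * E2 tt + c * tt := by
    rw [E2_S tt vv vv_tt, hc]; ring
  rw [vv_zz, E2_add_int, e2z] at e2v
  have ttw : (tt : ℂ) * r = -w := by rw [htt, hom]; linear_combination hr2 / 38
  have e2t : E2 tt = -19 * E2 w + 2 * r * c := by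
    have : w ^ 2 * (E2 tt - (-19 * E2 w + 2 * r * c)) = 0 := by
      linear_combination (-(r ^ 2)) * e2v - (E2 tt * (tt * r - w) + c * r) * ttw
        + w ^ 2 * E2 w * hr2 + c * r * w * hrw
    have := (mul_eq_zero.mp this).resolve_left (pow_ne_zero _ om0)
    linear_combination this
  have e2N := E2N_eq 19 tt uu (by rw [huu, htt]; push_cast; ring)
  rw [e2t, uu_om, E2_add_int] at e2N
  obtain ⟨x, y, r2, r4, r6, r8⟩ := five_rel zz ww ww_zz
  rw [G2_eq, G2_eq, ww_om, E2_add_int, e2z] at r2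
  rw [q4] at r4
  rw [q6] at r6
  rw [q8, Gz_eight] at r8
  obtain ⟨hB, hQ⟩ := alg5 (1 - w) x y (Gz 4 zz) (Gz 6 zz) he r4 r6 r8
  set Y : ℂ := E2 w - r * c / 19 with hY
  have hs : x + y = 5 * (Real.pi : ℂ) ^ 2 / 6 * (10 - w) * Y := by
    linear_combination r2 / 2 - 5 * (Real.pi : ℂ) ^ 2 / 6 * E2 w * w2
      - 5 * (Real.pi : ℂ) ^ 2 / 6 * c / 19 * (2 * w2 - (10 - w) * hrw)
  generalize x + y = s at hB hQ hs
  have near4 := E4_near w h13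
  have near6 := E6_near w h13
  have E40 : E4 w ≠ 0 := by
    intro h; rw [h] at near4; norm_num at near4
  have A0 : Gz 4 zz ≠ 0 := by
    rw [A_eq]
    exact mul_ne_zero (pow_ne_zero _ om0) (mul_ne_zero (div_ne_zero (pow_ne_zero _ hpi)
      (by norm_num)) E40)
  rcases mul_eq_zero.mp hQ with h | h
  · have hA : Gz 4 zz = (8 / 375 + 2 / 375 * (1 - w)) * s ^ 2 := sub_eq_zero.mp h
    have s0 : s ≠ 0 := by rintro rfl; apply A0; rw [hA]; ring
    have Y0 : Y ≠ 0 := by rintro h0; apply s0; rw [hs, h0]; ring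
    have hB' : Gz 6 zz = (-31/17500 - 1/1250 * (1 - w)) * s ^ 3 := by
      rw [hB, hA]; linear_combination (-162 / (560 * 375)) * s ^ 3 * he
    refine ⟨Y, ?_, Y0, ?_, ?_⟩
    · rw [← htt, hY]; push_cast at e2N; linear_combination e2N / 24
    · rw [← huu, uu_om, E4_add_int]
      rw [A_eq, hs] at hA
      have : (w ^ 4 * (Real.pi : ℂ) ^ 4 / 45) * (E4 w - 19 / 6 * Y ^ 2) = 0 := by
        linear_combination hA + ((Real.pi : ℂ) ^ 4 / 45) * Y ^ 2 *
          (50 / 12 * w2 - 1 / 6 * w3 - 19 / 6 * w4)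
      have := (mul_eq_zero.mp this).resolve_left (div_ne_zero (mul_ne_zero (pow_ne_zero _ om0)
        (pow_ne_zero _ hpi)) (by norm_num))
      linear_combination this
    · rw [← huu, uu_om, E6_add_int]
      rw [B_eq, hs] at hB'
      have : (w ^ 6 * (Real.pi : ℂ) ^ 6 * 2 / 945) * (E6 w - 361 / 64 * Y ^ 3) = 0 := by
        linear_combination hB' + ((Real.pi : ℂ) ^ 6 * 2 / 945) * Y ^ 3 * (1 / 64) *
          (-5550 * w2 + 465 * w3 - 14 * w4 - 361 * w6)
      have := (mul_eq_zero.mp this).resolve_left (div_ne_zero (mul_ne_zero (mul_ne_zero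
        (pow_ne_zero _ om0) (pow_ne_zero _ hpi)) (by norm_num)) (by norm_num))
      linear_combination this
  · exfalso
    have hA : Gz 4 zz = (38 / 375 + 22 / 375 * (1 - w)) * s ^ 2 := sub_eq_zero.mp h
    have hsp := spurious (1 - w) s _ _ he hA hB
    rw [A_eq, B_eq] at hsp
    have hd : E6 w ^ 2 = (-15781149/212629504 + 127008027/212629504 * (1 - w)) * E4 w ^ 3 := by
      have : (w ^ 12 * (Real.pi : ℂ) ^ 12 / 45 ^ 3) * (E6 w ^ 2 -
          (-15781149/212629504 + 127008027/212629504 * (1 - w)) * E4 w ^ 3) = 0 := by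
        linear_combination hsp
      have := (mul_eq_zero.mp this).resolve_left (div_ne_zero (mul_ne_zero
        (pow_ne_zero _ om0) (pow_ne_zero _ hpi)) (by norm_num))
      linear_combination this
    have hwim : w.im = Real.sqrt 19 / 2 := by rw [hom]; simp [hrim]
    have hwre : w.re = 1 / 2 := by rw [hom]; simp [hrre]
    refine near_contra _ _ _ near4 near6 ?_ ?_ hd
    · refine (Complex.norm_le_abs_re_add_abs_im _).trans ?_
      have h1 : (-15781149/212629504 + 127008027/212629504 * (1 - w)).re =
        -15781149/212629504 + 127008027/212629504 * (1 / 2) := by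
        have := re_lin (-15781149/212629504) (127008027/212629504) w
        push_cast at this
        rw [this, hwre]; norm_num
      have h2 : (-15781149/212629504 + 127008027/212629504 * (1 - w)).im =
        -(127008027/212629504 * (Real.sqrt 19 / 2)) := by
        have := im_lin (-15781149/212629504) (127008027/212629504) w
        push_cast at this
        rw [this, hwim]; ring
      rw [h1, h2, abs_neg, abs_of_nonneg (by norm_num), abs_of_nonneg (by positivity)]
      linarith
    · refine le_trans ?_ (Complex.abs_im_le_norm _)
      have h2 : (-15781149/212629504 + 127008027/212629504 * (1 - w) - 1).im =
        -(127008027/212629504 * (Real.sqrt 19 / 2)) := by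
        have := im_lin (-15781149/212629504) (127008027/212629504) w
        push_cast at this
        rw [Complex.sub_im, this, hwim, Complex.one_im]; ring
      rw [h2, abs_neg, abs_of_nonneg (by positivity)]
      linarith

/-- At the Heegner point `τ = (−19 + i√19)/38` of discriminant `−19`, the codomain
invariants `a₄′` and `a₆′` take the stated rational values. -/
theorem a4'_a6'_at_heegner_19 :
    E2N 19 ((-19 + Complex.I * (Real.sqrt 19 : ℂ)) / 38) ≠ 0 ∧
    a4' 19 ((-19 + Complex.I * (Real.sqrt 19 : ℂ)) / 38) = -1 / 38 ∧
    a6' 19 ((-19 + Complex.I * (Real.sqrt 19 : ℂ)) / 38) = 1 / 608 := by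
  obtain ⟨Y, h2, hY, h4, h6⟩ := heegner_core _ rfl
  refine ⟨?_, ?_, ?_⟩
  · rw [h2]; exact mul_ne_zero (by norm_num) hY
  · rw [a4', h2, show ((19 : ℕ) : ℂ) = 19 by norm_num, h4]
    field_simp; norm_num
  · rw [a6', h2, show ((19 : ℕ) : ℂ) = 19 by norm_num, h6]
    field_simp; norm_num
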